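/- Let β ∈ [0,2], assuming y_i > 0 for all i in the case β = 0, and let μ* ∈ M₊(K) be a minimizer of ℓ over M₊(K). Then Σ_{i=1}^m y_i (Aμ*)_i^{β−1} = Σ_{i=1}^m (Aμ*)_i^{β}, where every term in either sum whose factor (Aμ*)_i equals 0 is interpreted as 0. -/

import Mathlib

open MeasureTheory Real Set

noncomputable def dbeta (β u v : ℝ) : EReal :=
  if β = 0 then
    if u = 0 ∨ v = 0 then ⊤ else ((u / v - Real.log (u / v) - 1 : ℝ) : EReal)
  else if β = 1 then
    if v = 0 ∧ 0 < u then ⊤ else ((v - u - u * Real.log (v / u) : ℝ) : EReal)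
  else if β < 1 then
    if v = 0 ∧ 0 < u then ⊤
    else (((u ^ β + (β - 1) * v ^ β - β * u * v ^ (β - 1)) / (β * (β - 1)) : ℝ) : EReal)
  else (((u ^ β + (β - 1) * v ^ β - β * u * v ^ (β - 1)) / (β * (β - 1)) : ℝ) : EReal)

noncomputable def Dbeta {m : ℕ} (β : ℝ) (y w : Fin m → ℝ) : EReal :=
  ∑ i, dbeta β (y i) (w i)

noncomputable def lamvec {m : ℕ} (β : ℝ) (y w : Fin m → ℝ) : Fin m → ℝ := fun i =>
  if 0 < w i then (w i) ^ (β - 2) * (w i - y i)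
  else if β = 2 then -(y i) else 0


lemma dbeta_ne_bot (β u v : ℝ) : dbeta β u v ≠ ⊥ := by
  unfold dbeta
  split_ifs <;> first | exact EReal.coe_ne_bot _ | exact top_ne_bot

lemma dbeta_ne_top (β u v : ℝ) (hu : β = 0 → 0 < u) (hv : 0 < v) : dbeta β u v ≠ ⊤ := by
  unfold dbeta
  split_ifs with h1 h2 h3 h4 h5 h6
  · rcases h2 with h2 | h2
    · exact absurd h2 (hu h1).ne'
    · exact absurd h2 hv.ne'
  all_goals first | exact EReal.coe_ne_top _ | exact absurd (And.left ‹_›) hv.ne'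

lemma general_deriv (β u v : ℝ) (h0 : β ≠ 0) (h1 : β ≠ 1) (hv : 0 < v) :
    HasDerivAt (fun t : ℝ => (u ^ β + (β - 1) * (t * v) ^ β - β * u * (t * v) ^ (β - 1)) / (β * (β - 1)))
      (v ^ β - u * v ^ (β - 1)) 1 := by
  have hl : HasDerivAt (fun t : ℝ => t * v) v 1 := by
    simpa using (hasDerivAt_id (1:ℝ)).mul_const v
  have hA := hl.rpow_const (p := β) (Or.inl (by simpa using hv.ne'))
  have hB := hl.rpow_const (p := β - 1) (Or.inl (by simpa using hv.ne'))
  have h := (((hA.const_mul (β - 1)).const_add (u ^ β)).sub (hB.const_mul (β * u))).div_const (β * (β - 1))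
  refine h.congr_deriv ?_
  have h1' : β - 1 ≠ 0 := sub_ne_zero.mpr h1
  have e1 : v ^ β = v ^ (β - 1) * v := by
    rw [← Real.rpow_add_one hv.ne']; ring_nf
  have e2 : v ^ (β - 1) = v ^ (β - 1 - 1) * v := by
    rw [← Real.rpow_add_one hv.ne']; ring_nf
  rw [one_mul, e1, e2]
  field_simp

lemma dbeta_deriv (β u v : ℝ) (hu : β = 0 → 0 < u) (hv : 0 < v) :
    HasDerivAt (fun t : ℝ => (dbeta β u (t * v)).toReal) (v ^ β - u * v ^ (β - 1)) 1 := by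
  have hpos : ∀ᶠ t : ℝ in nhds 1, 0 < t := lt_mem_nhds one_pos
  by_cases h0 : β = 0
  · have hup := hu h0
    subst h0
    have hd : HasDerivAt (fun t : ℝ => (u / v) * t⁻¹ - (Real.log (u / v) - Real.log t) - 1)
        (v ^ (0:ℝ) - u * v ^ ((0:ℝ) - 1)) 1 := by
      have h := (((hasDerivAt_inv (one_ne_zero (α := ℝ))).const_mul (u / v)).sub
        ((Real.hasDerivAt_log (one_ne_zero (α := ℝ))).const_sub (Real.log (u / v)))).sub_const 1
      refine h.congr_deriv ?_
      rw [zero_sub, Real.rpow_neg_one, Real.rpow_zero]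
      field_simp
      ring
    refine hd.congr_of_eventuallyEq ?_
    filter_upwards [hpos] with t ht
    have : ¬ (u = 0 ∨ t * v = 0) := by
      push Not; exact ⟨hup.ne', (mul_pos ht hv).ne'⟩
    simp only [dbeta, if_true, if_neg this, EReal.toReal_coe]
    rw [← Real.log_div (div_pos hup hv).ne' ht.ne', div_div, mul_comm v t]
    congr 2
    field_simp
  by_cases h1 : β = 1
  · subst h1
    have hd : HasDerivAt (fun t : ℝ => t * v - u - u * (Real.log t + Real.log (v / u)))
        (v ^ (1:ℝ) - u * v ^ ((1:ℝ) - 1)) 1 := by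
      have h := (((hasDerivAt_id (1:ℝ)).mul_const v).sub_const u).sub
        (((Real.hasDerivAt_log (one_ne_zero (α := ℝ))).add_const (Real.log (v / u))).const_mul u)
      refine h.congr_deriv ?_
      simp
    refine hd.congr_of_eventuallyEq ?_
    filter_upwards [hpos] with t ht
    have : ¬ (t * v = 0 ∧ 0 < u) := fun h => (mul_pos ht hv).ne' h.1
    simp only [dbeta, if_neg h0, if_true, if_neg this, EReal.toReal_coe]
    by_cases hu0 : u = 0
    · simp [hu0]
    · rw [mul_div_assoc, Real.log_mul ht.ne' (div_ne_zero hv.ne' hu0)]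
  refine (general_deriv β u v h0 h1 hv).congr_of_eventuallyEq ?_
  filter_upwards [hpos] with t ht
  have : ¬ (t * v = 0 ∧ 0 < u) := fun h => (mul_pos ht hv).ne' h.1
  simp only [dbeta, if_neg h0, if_neg h1, if_neg this, ite_self, EReal.toReal_coe]

lemma esum_coe {m : ℕ} (f : Fin m → ℝ) : ((∑ i, f i : ℝ) : EReal) = ∑ i, (f i : EReal) := by
  induction (Finset.univ : Finset (Fin m)) using Finset.induction_on with
  | empty => simp
  | insert a s ha ih => rw [Finset.sum_insert ha, Finset.sum_insert ha, EReal.coe_add, ih]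

lemma esum_ne_bot {m : ℕ} (f : Fin m → EReal) (s : Finset (Fin m)) (h : ∀ i, f i ≠ ⊥) :
    ∑ i ∈ s, f i ≠ ⊥ := by
  induction s using Finset.induction_on with
  | empty => simp
  | insert a s ha ih =>
    rw [Finset.sum_insert ha, Ne, EReal.add_eq_bot_iff]
    exact fun hh => hh.elim (h a) ih

lemma Dbeta_coe {m : ℕ} (β : ℝ) (y w : Fin m → ℝ) (h : ∀ i, dbeta β (y i) (w i) ≠ ⊤) :
    Dbeta β y w = ((∑ i, (dbeta β (y i) (w i)).toReal : ℝ) : EReal) := by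
  rw [esum_coe]
  exact Finset.sum_congr rfl fun i _ => (EReal.coe_toReal (h i) (dbeta_ne_bot _ _ _)).symm

lemma Dbeta_fin {m : ℕ} (β : ℝ) (y w : Fin m → ℝ) (h : Dbeta β y w ≠ ⊤) (i : Fin m) :
    dbeta β (y i) (w i) ≠ ⊤ := by
  intro hi
  apply h
  unfold Dbeta
  rw [← Finset.add_sum_erase _ _ (Finset.mem_univ i), hi]
  exact EReal.top_add_of_ne_bot (esum_ne_bot _ _ fun j => dbeta_ne_bot _ _ _)

/-- At any minimiser μ*, Σᵢ yᵢ (Aμ*)ᵢ^{β−1} = Σᵢ (Aμ*)ᵢ^β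
(terms with (Aμ*)ᵢ = 0 interpreted as 0). -/
theorem stmt9 {p m : ℕ} (hp : 1 ≤ p) (hm : 1 ≤ m)
    (K : Set (EuclideanSpace ℝ (Fin p))) (hK : IsCompact K)
    (a : Fin m → C(K, ℝ)) (ha0 : ∀ i x, 0 ≤ a i x) (hane : ∀ i, ∃ x, a i x ≠ 0)
    (y : Fin m → ℝ) (hy : ∀ i, 0 ≤ y i)
    (β : ℝ) (hβ : β ∈ Icc (0:ℝ) 2)
    (hy0 : β = 0 → ∀ i, 0 < y i)
    (μstar : Measure K) (hμstar : IsFiniteMeasure μstar)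
    (w : Fin m → ℝ) (hw : w = fun i => ∫ x, a i x ∂μstar)
    (hmin : ∀ ν : Measure K, IsFiniteMeasure ν →
      Dbeta β y w ≤ Dbeta β y (fun i => ∫ x, a i x ∂ν)) :
    ∑ i, (if w i = 0 then 0 else y i * w i ^ (β - 1)) =
      ∑ i, (if w i = 0 then 0 else w i ^ β) := by
  have hcK : CompactSpace K := isCompact_iff_compactSpace.mp hK
  have hint : ∀ (i : Fin m) (ν : Measure K), IsFiniteMeasure ν → Integrable (a i) ν := by
    intro i ν hν
    exact (a i).continuous.integrable_of_hasCompactSupport (HasCompactSupport.of_compactSpace _)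
  have hw0 : ∀ i, 0 ≤ w i := by
    intro i; rw [hw]; exact integral_nonneg (ha0 i)
  -- finiteness
  have hfin : ∀ i, dbeta β (y i) (w i) ≠ ⊤ := by
    choose x hx using hane
    let ν : Measure K := ∑ j, Measure.dirac (x j)
    have hν : IsFiniteMeasure ν := by infer_instance
    have hpos : ∀ i, 0 < ∫ z, a i z ∂ν := by
      intro i
      have : ∫ z, a i z ∂ν = ∑ j, a i (x j) := by
        rw [integral_finset_sum_measure (fun j _ => hint i _ inferInstance)]
        simp
      rw [this]
      exact Finset.sum_pos' (fun j _ => ha0 i _)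
        ⟨i, Finset.mem_univ i, lt_of_le_of_ne (ha0 i _) (hx i).symm⟩
    apply Dbeta_fin
    have h := hmin ν hν
    rw [Dbeta_coe β y (fun i => ∫ z, a i z ∂ν)
      (fun i => dbeta_ne_top _ _ _ (fun h => hy0 h i) (hpos i))] at h
    exact ne_top_of_le_ne_top (EReal.coe_ne_top _) h
  let F : ℝ → ℝ := fun t => ∑ i, (dbeta β (y i) (t * w i)).toReal
  have hloc : IsLocalMin F 1 := by
    have hpos : ∀ᶠ t : ℝ in nhds 1, 0 < t := lt_mem_nhds one_pos
    filter_upwards [hpos] with t ht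
    have hf2 : ∀ i, dbeta β (y i) (t * w i) ≠ ⊤ := by
      intro i
      rcases (hw0 i).eq_or_lt with h | h
      · have := hfin i
        rw [← h] at this ⊢
        simpa using this
      · exact dbeta_ne_top _ _ _ (fun h => hy0 h i) (mul_pos ht h)
    have h := hmin (t.toNNReal • μstar) inferInstance
    have e : (fun i => ∫ z, a i z ∂(t.toNNReal • μstar)) = fun i => t * w i := by
      funext i
      rw [integral_smul_nnreal_measure, hw, NNReal.smul_def, Real.coe_toNNReal _ ht.le, smul_eq_mul]
    rw [e, Dbeta_coe _ _ _ hfin, Dbeta_coe _ _ _ hf2, EReal.coe_le_coe_iff] at h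
    simpa [F] using h
  have hder : HasDerivAt F
      (∑ i, ((if w i = 0 then 0 else w i ^ β) - (if w i = 0 then 0 else y i * w i ^ (β - 1)))) 1 := by
    apply HasDerivAt.fun_sum
    intro i _
    by_cases h : w i = 0
    · simp only [h, if_true, mul_zero, sub_zero]
      exact hasDerivAt_const _ _
    · simp only [h, if_false]
      exact dbeta_deriv _ _ _ (fun h => hy0 h i) (lt_of_le_of_ne (hw0 i) (Ne.symm h))
  have h := hloc.hasDerivAt_eq_zero hder
  rw [Finset.sum_sub_distrib] at h
  linarith
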